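/- arXiv:1410.7600 — 3 statements merged into one kernel-verified Lean document; each statement's English description precedes it below -/
import Mathlib

section
/- Let 0 < β₁ < β₂, ε > 0, ρ > 2, N₀ ∈ ℕ, and let θ = (θ_k)_{k≥1} be a real sequence satisfying the self-similarity condition at level β₁: ∑_{k=N}^{⌊ρN⌋} θ_k² ≥ ε ‖θ‖²_{S^{β₁}} N^{−2β₁} for all N ≥ N₀. If moreover ‖θ‖²_{S^{β₂}} = ∑_{k≥1} θ_k² k^{2β₂} < ∞, then ‖θ‖_{S^{β₁}} = 0, i.e. θ is the zero sequence. In other words, a nonzero sequence cannot be self-similar at regularity level β₁ while belonging to the Sobolev space of a strictly higher regularity β₂. -/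
open scoped BigOperators

/-- A block of squares starting at `N` is controlled by the Sobolev norm times `N ^ (-2β)`. -/
theorem rpow_mul_sum_Icc_sq_le_tsum {θ : ℕ → ℝ} {s : ℝ} (hs : 0 ≤ s)
    (hsum : Summable fun k : ℕ => θ k ^ 2 * (k : ℝ) ^ s) (N M : ℕ) :
    (N : ℝ) ^ s * ∑ k ∈ Finset.Icc N M, θ k ^ 2 ≤ ∑' k : ℕ, θ k ^ 2 * (k : ℝ) ^ s := by
  calc (N : ℝ) ^ s * ∑ k ∈ Finset.Icc N M, θ k ^ 2
      ≤ ∑ k ∈ Finset.Icc N M, θ k ^ 2 * (k : ℝ) ^ s := by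
        rw [Finset.mul_sum]
        refine Finset.sum_le_sum fun k hk => ?_
        rw [mul_comm]
        have hNk : (N : ℝ) ≤ k := Nat.cast_le.mpr (Finset.mem_Icc.mp hk).1
        gcongr
    _ ≤ ∑' k : ℕ, θ k ^ 2 * (k : ℝ) ^ s :=
        hsum.sum_le_tsum _ fun k _ => by positivity

/-- A nonzero sequence cannot be self-similar at regularity level `β₁` while belonging to the
Sobolev space of a strictly higher regularity `β₂`: if `θ` satisfies the self-similarity
condition at level `β₁` and `∑_{k≥1} θ_k² k^{2β₂} < ∞` for some `β₂ > β₁`, then `θ_k = 0`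
for all `k ≥ 1`. -/
theorem selfSimilar_higher_regularity_zero (β₁ β₂ ε ρ : ℝ) (hβ₁ : 0 < β₁) (hβ₁₂ : β₁ < β₂)
    (hε : 0 < ε) (hρ : 2 < ρ) (N₀ : ℕ) (hN₀ : 1 ≤ N₀) (θ : ℕ → ℝ)
    (hss : ∀ N : ℕ, N₀ ≤ N →
      ε * (∑' k : ℕ, θ (k + 1) ^ 2 * ((k + 1 : ℕ) : ℝ) ^ (2 * β₁)) * (N : ℝ) ^ (-(2 * β₁))
        ≤ ∑ k ∈ Finset.Icc N ⌊ρ * N⌋₊, θ k ^ 2)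
    (hsum₂ : Summable (fun k : ℕ => θ (k + 1) ^ 2 * ((k + 1 : ℕ) : ℝ) ^ (2 * β₂))) :
    ∀ k : ℕ, 1 ≤ k → θ k = 0 := by
  set S₁ := ∑' k : ℕ, θ (k + 1) ^ 2 * ((k + 1 : ℕ) : ℝ) ^ (2 * β₁) with hS₁
  have hsum₁ : Summable (fun k : ℕ => θ (k + 1) ^ 2 * ((k + 1 : ℕ) : ℝ) ^ (2 * β₁)) := by
    refine Summable.of_nonneg_of_le (fun k => by positivity) (fun k => ?_) hsum₂
    have hk : (1 : ℝ) ≤ ((k + 1 : ℕ) : ℝ) := by exact_mod_cast Nat.le_add_left 1 k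
    gcongr
  have hsum : Summable fun k : ℕ => θ k ^ 2 * (k : ℝ) ^ (2 * β₂) :=
    (summable_nat_add_iff (f := fun k : ℕ => θ k ^ 2 * (k : ℝ) ^ (2 * β₂)) 1).mp hsum₂
  set S₂ := ∑' k : ℕ, θ k ^ 2 * (k : ℝ) ^ (2 * β₂)
  have hbound : ∀ N : ℕ, N₀ ≤ N → ε * S₁ * (N : ℝ) ^ (2 * (β₂ - β₁)) ≤ S₂ := by
    intro N hN
    have hNpos : (0 : ℝ) < N := by exact_mod_cast hN₀.trans hN
    calc ε * S₁ * (N : ℝ) ^ (2 * (β₂ - β₁))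
        = (N : ℝ) ^ (2 * β₂) * (ε * S₁ * (N : ℝ) ^ (-(2 * β₁))) := by
          rw [show 2 * (β₂ - β₁) = 2 * β₂ + -(2 * β₁) by ring, Real.rpow_add hNpos]
          ring
      _ ≤ (N : ℝ) ^ (2 * β₂) * ∑ k ∈ Finset.Icc N ⌊ρ * N⌋₊, θ k ^ 2 := by
          gcongr
          exact hss N hN
      _ ≤ S₂ := rpow_mul_sum_Icc_sq_le_tsum (by linarith) hsum _ _
  have hS₁_nonneg : 0 ≤ S₁ := tsum_nonneg fun k => by positivity
  have hS₁_zero : S₁ = 0 := by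
    by_contra hne
    have hpos : 0 < ε * S₁ := mul_pos hε (hS₁_nonneg.lt_of_ne' hne)
    have htend : Filter.Tendsto (fun N : ℕ => ε * S₁ * (N : ℝ) ^ (2 * (β₂ - β₁)))
        Filter.atTop Filter.atTop :=
      ((tendsto_rpow_atTop (by linarith)).comp
        tendsto_natCast_atTop_atTop).const_mul_atTop hpos
    obtain ⟨N, hlt, hN⟩ :=
      ((htend.eventually_gt_atTop S₂).and (Filter.eventually_ge_atTop N₀)).exists
    exact (hbound N hN).not_gt hlt
  intro k hk
  obtain ⟨j, rfl⟩ := Nat.exists_eq_add_of_le' hk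
  have hle := hsum₁.le_tsum j fun i _ => by positivity
  rw [← hS₁, hS₁_zero] at hle
  have hjpos : (0 : ℝ) < ((j + 1 : ℕ) : ℝ) ^ (2 * β₁) := by positivity
  have hsq : θ (j + 1) ^ 2 ≤ 0 := nonpos_of_mul_nonpos_left hle hjpos
  exact pow_eq_zero_iff two_ne_zero |>.mp (le_antisymm hsq (sq_nonneg _))
end

section
/- Let ρ > 2, L₀ > 0, N₀ ∈ ℕ, and let θ = (θ_k)_{k≥1} be a real sequence satisfying the polished tail condition: ∑_{k=N}^{⌊ρN⌋} θ_k² ≥ L₀^{−1} ∑_{k≥N} θ_k² for all N ≥ N₀. If in addition ‖θ‖²_{S^{β}} = ∑_{k≥1} θ_k² k^{2β} < ∞ for some β > 0, then the full tail inherits the Sobolev decay: ∑_{k≥N} θ_k² ≤ L₀ ‖θ‖²_{S^{β}} N^{−2β} for all N ≥ N₀. -/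
open scoped BigOperators

/-- A block sum of squares starting at `N` is bounded by `N ^ (-s)` times the weighted norm. -/
theorem sum_Icc_sq_le_tsum_mul_rpow_neg {s : ℝ} (hs : 0 < s) {N : ℕ} (hN : 1 ≤ N) (M : ℕ)
    (θ : ℕ → ℝ)
    (hsum : Summable (fun k : ℕ => θ (k + 1) ^ 2 * ((k + 1 : ℕ) : ℝ) ^ s)) :
    ∑ k ∈ Finset.Icc N M, θ k ^ 2
      ≤ (∑' k : ℕ, θ (k + 1) ^ 2 * ((k + 1 : ℕ) : ℝ) ^ s) * (N : ℝ) ^ (-s) := by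
  have hN' : (0 : ℝ) < N := by exact_mod_cast hN
  have hF : Summable (fun k : ℕ => θ k ^ 2 * (k : ℝ) ^ s) := (summable_nat_add_iff 1).1 hsum
  have hF_tsum : ∑' k : ℕ, θ k ^ 2 * (k : ℝ) ^ s
      = ∑' k : ℕ, θ (k + 1) ^ 2 * ((k + 1 : ℕ) : ℝ) ^ s := by
    rw [hF.tsum_eq_zero_add]
    simp [Real.zero_rpow hs.ne']
  rw [← hF_tsum, Real.rpow_neg hN'.le, ← div_eq_mul_inv, le_div_iff₀ (by positivity),
    Finset.sum_mul]
  calc ∑ k ∈ Finset.Icc N M, θ k ^ 2 * (N : ℝ) ^ s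
      ≤ ∑ k ∈ Finset.Icc N M, θ k ^ 2 * (k : ℝ) ^ s := by
        refine Finset.sum_le_sum fun k hk => ?_
        have hk' : (N : ℝ) ≤ k := by exact_mod_cast (Finset.mem_Icc.1 hk).1
        gcongr
    _ ≤ ∑' k : ℕ, θ k ^ 2 * (k : ℝ) ^ s :=
        hF.sum_le_tsum _ fun k _ => by positivity

/-- A polished tail sequence with finite Sobolev norm has a full tail inheriting the Sobolev
decay: if `∑_{k=N}^{⌊ρN⌋} θ_k² ≥ L₀⁻¹ ∑_{k≥N} θ_k²` for all `N ≥ N₀` and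
`∑_{k≥1} θ_k² k^{2β} < ∞`, then `∑_{k≥N} θ_k² ≤ L₀ ‖θ‖²_{S^β} N^{-2β}` for all `N ≥ N₀`. -/
theorem polishedTail_tail_decay (ρ L₀ β : ℝ) (hρ : 2 < ρ) (hL₀ : 0 < L₀) (hβ : 0 < β)
    (N₀ : ℕ) (hN₀ : 1 ≤ N₀) (θ : ℕ → ℝ)
    (hpt : ∀ N : ℕ, N₀ ≤ N →
      L₀⁻¹ * (∑' k : ℕ, θ (N + k) ^ 2) ≤ ∑ k ∈ Finset.Icc N ⌊ρ * N⌋₊, θ k ^ 2)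
    (hsum : Summable (fun k : ℕ => θ (k + 1) ^ 2 * ((k + 1 : ℕ) : ℝ) ^ (2 * β))) :
    ∀ N : ℕ, N₀ ≤ N →
      (∑' k : ℕ, θ (N + k) ^ 2)
        ≤ L₀ * (∑' k : ℕ, θ (k + 1) ^ 2 * ((k + 1 : ℕ) : ℝ) ^ (2 * β)) * (N : ℝ) ^ (-(2 * β)) := by
  intro N hN
  rw [mul_assoc]
  exact (inv_mul_le_iff₀ hL₀).1 ((hpt N hN).trans
    (sum_Icc_sq_le_tsum_mul_rpow_neg (by positivity) (hN₀.trans hN) _ θ hsum))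
end

section
/- Let γ > 0, 0 < β ≤ 1 + 2γ, and B > 0. There exists a constant C = C(β, γ) < ∞ such that for every real sequence θ₀ = (θ_{0,k})_{k≥1} with ∑_{k≥1} θ_{0,k}² k^{2β} ≤ B² and every real n ≥ 1, the squared bias of the posterior mean satisfies ∑_{k=1}^{∞} (k^{1+2γ} θ_{0,k} / (n + k^{1+2γ}))² ≤ C · B² · n^{−2β/(1+2γ)}. -/
open scoped BigOperators

/-- For `0 ≤ s ≤ 1`, the shrinkage factor `x / (n + x)` is at most `(x / n) ^ s`. -/
theorem div_add_self_le_rpow {x n s : ℝ} (hx : 0 ≤ x) (hn : 0 < n) (hs : 0 ≤ s) (hs1 : s ≤ 1) :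
    x / (n + x) ≤ (x / n) ^ s :=
  calc x / (n + x) ≤ (x / (n + x)) ^ s :=
        Real.self_le_rpow_of_le_one (by positivity) (div_le_one_of_le₀ (by linarith) (by linarith))
          hs1
    _ ≤ (x / n) ^ s := by
        gcongr
        linarith

/-- Squared-bias bound for the posterior mean in the Gaussian sequence model: for `γ > 0` and
`0 < β ≤ 1 + 2γ` there is a constant `C = C(β, γ)` such that for every `B > 0`, every sequence
`θ₀` in the Sobolev ball `S^β(B)` and every real `n ≥ 1`,
`∑_{k≥1} (k^{1+2γ} θ_{0,k}/(n + k^{1+2γ}))² ≤ C · B² · n^{−2β/(1+2γ)}`. -/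
theorem posterior_mean_squared_bias_bound (γ β : ℝ) (hγ : 0 < γ) (hβ : 0 < β)
    (hβγ : β ≤ 1 + 2 * γ) :
    ∃ C : ℝ, 0 < C ∧ ∀ B : ℝ, 0 < B → ∀ θ : ℕ → ℝ,
      Summable (fun k : ℕ => θ (k + 1) ^ 2 * ((k + 1 : ℕ) : ℝ) ^ (2 * β)) →
      (∑' k : ℕ, θ (k + 1) ^ 2 * ((k + 1 : ℕ) : ℝ) ^ (2 * β)) ≤ B ^ 2 →
      ∀ n : ℝ, 1 ≤ n →
        (∑' k : ℕ, (((k + 1 : ℕ) : ℝ) ^ (1 + 2 * γ) * θ (k + 1)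
            / (n + ((k + 1 : ℕ) : ℝ) ^ (1 + 2 * γ))) ^ 2)
          ≤ C * B ^ 2 * n ^ (-(2 * β) / (1 + 2 * γ)) := by
  refine ⟨1, one_pos, fun B _ θ hsum hle n hn => ?_⟩
  have hn0 : 0 < n := by linarith
  have ha : 0 < 1 + 2 * γ := by linarith
  have key : ∀ k : ℕ, (((k + 1 : ℕ) : ℝ) ^ (1 + 2 * γ) * θ (k + 1)
      / (n + ((k + 1 : ℕ) : ℝ) ^ (1 + 2 * γ))) ^ 2
      ≤ θ (k + 1) ^ 2 * ((k + 1 : ℕ) : ℝ) ^ (2 * β) * n ^ (-(2 * β) / (1 + 2 * γ)) := by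
    intro k
    have hm : (0 : ℝ) ≤ ((k + 1 : ℕ) : ℝ) := Nat.cast_nonneg _
    generalize ((k + 1 : ℕ) : ℝ) = m at hm ⊢
    have hx : 0 ≤ m ^ (1 + 2 * γ) := by positivity
    have hfac := div_add_self_le_rpow hx hn0 (s := β / (1 + 2 * γ)) (by positivity)
      ((div_le_one ha).2 hβγ)
    calc (m ^ (1 + 2 * γ) * θ (k + 1) / (n + m ^ (1 + 2 * γ))) ^ 2
        = θ (k + 1) ^ 2 * (m ^ (1 + 2 * γ) / (n + m ^ (1 + 2 * γ))) ^ 2 := by ring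
      _ ≤ θ (k + 1) ^ 2 * ((m ^ (1 + 2 * γ) / n) ^ (β / (1 + 2 * γ))) ^ 2 := by gcongr
      _ = θ (k + 1) ^ 2 * m ^ (2 * β) * n ^ (-(2 * β) / (1 + 2 * γ)) := by
        rw [Real.div_rpow hx hn0.le, ← Real.rpow_mul hm, mul_div_cancel₀ _ ha.ne', div_pow,
          ← Real.rpow_mul_natCast hm, ← Real.rpow_mul_natCast hn0.le, neg_div,
          Real.rpow_neg hn0.le, mul_assoc, div_eq_mul_inv,
          div_mul_eq_mul_div, Nat.cast_ofNat, mul_comm β]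
  have hsum' := hsum.mul_right (n ^ (-(2 * β) / (1 + 2 * γ)))
  calc _ ≤ ∑' k : ℕ, θ (k + 1) ^ 2 * ((k + 1 : ℕ) : ℝ) ^ (2 * β)
        * n ^ (-(2 * β) / (1 + 2 * γ)) :=
        (hsum'.of_nonneg_of_le (fun _ => sq_nonneg _) key).tsum_le_tsum key hsum'
    _ ≤ 1 * B ^ 2 * n ^ (-(2 * β) / (1 + 2 * γ)) := by
        rw [tsum_mul_right, one_mul]
        gcongr
end
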